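/- Let X be a Hausdorff topological space with the property that every upper semicontinuous set-valued map with nonempty closed convex values, defined on a closed subset of X into [0,1], admits an upper semicontinuous extension with nonempty closed convex values defined on all of X into [0,1]. Then X is completely normal, i.e., any two subsets A, B of X satisfying cl(A) ∩ B = A ∩ cl(B) = ∅ can be separated by disjoint open sets. -/

import Mathlib

/-- A set-valued map `T` is upper semicontinuous at `x₀`. -/
def SetValuedUscAt {X : Type*} [TopologicalSpace X] (T : X → Set ℝ) (x₀ : X) : Prop :=
  ∀ V : Set ℝ, IsOpen V → T x₀ ⊆ V → ∃ U : Set X, IsOpen U ∧ x₀ ∈ U ∧ ∀ x ∈ U, T x ⊆ V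

/-- A set-valued map is upper semicontinuous if it is so at every point. -/
def SetValuedUsc {X : Type*} [TopologicalSpace X] (T : X → Set ℝ) : Prop :=
  ∀ x, SetValuedUscAt T x

/-- The points that an upper semicontinuous map sends into an open set form an open set. -/
theorem SetValuedUsc.isOpen_setOf_subset {X : Type*} [TopologicalSpace X] {T : X → Set ℝ}
    (hT : SetValuedUsc T) {V : Set ℝ} (hV : IsOpen V) : IsOpen {x | T x ⊆ V} := by
  rw [isOpen_iff_forall_mem_open]
  intro x hx
  obtain ⟨U, hU, hxU, h⟩ := hT x V hV hx
  exact ⟨U, h, hU, hxU⟩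

/-- On the union of two closed sets `C` and `D`, the map equal to `{0}` off `D`, to `{1}` off `C`
and to `[0,1]` on `C ∩ D` is upper semicontinuous. -/
theorem setValuedUsc_Icc_ite {X : Type*} [TopologicalSpace X] {C D : Set X}
    [DecidablePred (· ∈ C)] [DecidablePred (· ∈ D)] (hC : IsClosed C) (hD : IsClosed D) :
    SetValuedUsc fun x : ↥(C ∪ D) =>
      Set.Icc (if (x : X) ∈ C then (0 : ℝ) else 1) (if (x : X) ∈ D then (1 : ℝ) else 0) := by
  rintro ⟨x, hx⟩ V - hxV
  by_cases hxC : x ∈ C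
  · by_cases hxD : x ∈ D
    · refine ⟨Set.univ, isOpen_univ, trivial, fun y _ => subset_trans ?_ hxV⟩
      apply Set.Icc_subset_Icc <;> simp only [hxC, hxD, if_true] <;> split_ifs <;> norm_num
    · refine ⟨_, hD.isOpen_compl.preimage continuous_subtype_val, hxD, ?_⟩
      rintro ⟨y, hy⟩ hyD
      have hyD : y ∉ D := hyD
      have hyC : y ∈ C := hy.resolve_right hyD
      simpa only [hxC, hxD, hyC, hyD] using hxV
  · have hxD : x ∈ D := hx.resolve_left hxC
    refine ⟨_, hC.isOpen_compl.preimage continuous_subtype_val, hxC, ?_⟩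
    rintro ⟨y, hy⟩ hyC
    have hyC : y ∉ C := hyC
    have hyD : y ∈ D := hy.resolve_left hyC
    simpa only [hxC, hxD, hyC, hyD] using hxV

/-- If every usc set-valued map with nonempty closed convex values
in `[0,1]` on a closed subset of a Hausdorff space `X` extends to `X`, then `X` is
completely normal: any `A, B` with `cl(A) ∩ B = A ∩ cl(B) = ∅` can be separated by
disjoint open sets. -/
theorem completelyNormal_of_usc_extension
    {X : Type*} [TopologicalSpace X] [T2Space X]
    (hext : ∀ (A : Set X), IsClosed A → ∀ T : A → Set ℝ,
      SetValuedUsc T →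
      (∀ a, T a ⊆ Set.Icc (0 : ℝ) 1) →
      (∀ a, (T a).Nonempty) →
      (∀ a, IsClosed (T a)) →
      (∀ a, Convex ℝ (T a)) →
      ∃ T' : X → Set ℝ, SetValuedUsc T' ∧
        (∀ x, T' x ⊆ Set.Icc (0 : ℝ) 1) ∧
        (∀ x, (T' x).Nonempty) ∧
        (∀ x, IsClosed (T' x)) ∧
        (∀ x, Convex ℝ (T' x)) ∧
        (∀ a : A, T' (a : X) = T a)) :
    ∀ A B : Set X, closure A ∩ B = ∅ → A ∩ closure B = ∅ →
      ∃ U V : Set X, IsOpen U ∧ IsOpen V ∧ A ⊆ U ∧ B ⊆ V ∧ U ∩ V = ∅ := by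
  classical
  intro A B hAB hBA
  have hA : ∀ x ∈ A, x ∉ closure B := fun x hx h => hBA.subset ⟨hx, h⟩
  have hB : ∀ x ∈ B, x ∉ closure A := fun x hx h => hAB.subset ⟨h, hx⟩
  obtain ⟨T, hT, -, hne, -, -, hTeq⟩ := hext (closure A ∪ closure B)
    (isClosed_closure.union isClosed_closure) _
    (setValuedUsc_Icc_ite isClosed_closure isClosed_closure)
    (fun x => by
      apply Set.Icc_subset_Icc <;> split_ifs <;> norm_num)
    (fun x => by
      rw [Set.nonempty_Icc]
      rcases x.2 with h | h <;> simp only [h, if_true] <;> split_ifs <;> norm_num)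
    (fun _ => isClosed_Icc) (fun _ => convex_Icc _ _)
  refine ⟨{x | T x ⊆ Set.Iio (1 / 2)}, {x | T x ⊆ Set.Ioi (1 / 2)},
    hT.isOpen_setOf_subset isOpen_Iio, hT.isOpen_setOf_subset isOpen_Ioi, ?_, ?_, ?_⟩
  · intro x hx
    have h := hTeq ⟨x, Or.inl (subset_closure hx)⟩
    simp only [subset_closure hx, hA x hx, if_true, if_false, Set.Icc_self] at h
    simp [h]
  · intro x hx
    have h := hTeq ⟨x, Or.inr (subset_closure hx)⟩
    simp only [subset_closure hx, hB x hx, if_true, if_false, Set.Icc_self] at h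
    simp only [Set.mem_ofPred_eq, h, Set.singleton_subset_iff, Set.mem_Ioi]
    norm_num
  · rw [Set.eq_empty_iff_forall_notMem]
    rintro x ⟨hU, hV⟩
    obtain ⟨y, hy⟩ := hne x
    exact lt_asymm (Set.mem_Iio.mp (hU hy)) (Set.mem_Ioi.mp (hV hy))
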